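/- arXiv:1905.00111 — 13 statements merged into one kernel-verified Lean document; each statement's English description precedes it below -/
import Mathlib

section
/- Let A be a nonempty subset of S × X^n. If d_n((s0,x),(ŝ0,x̂)) ≤ β for all (s0,x),(ŝ0,x̂) ∈ A, then there exists a single sequence y ∈ ℤ^n such that y ∈ Y^n(s0,x) for every (s0,x) ∈ A (i.e., all input pairs in A share a common feasible request). -/
/-- Battery state at time `i` given initial state `s0`, consumption `x`, and request `y`:
`s_i = s0 + Σ_{k<i} y_k − Σ_{k<i} x_k`. -/
def battState (s0 : ℤ) (x y : ℕ → ℤ) (i : ℕ) : ℤ :=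
  s0 + (∑ k ∈ Finset.range i, y k) - ∑ k ∈ Finset.range i, x k

/-- `y` is a feasible request sequence for input pair `(s0, x)` over horizon `n`
with battery capacity `β`: all battery states stay in `{0,…,β}`. -/
def feasible (β n : ℕ) (s0 : ℤ) (x y : ℕ → ℤ) : Prop :=
  ∀ i ≤ n, 0 ≤ battState s0 x y i ∧ battState s0 x y i ≤ (β : ℤ)

/-- `x` is a consumption sequence with entries in `{0,…,α}` on the first `n` steps. -/
def inX (α n : ℕ) (x : ℕ → ℤ) : Prop :=
  ∀ k < n, 0 ≤ x k ∧ x k ≤ (α : ℤ)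

/-- Distance `d_n` between input pairs `(s0,x)` and `(t0,z)`:
`max_{0 ≤ i ≤ n−1} |(s0 − Σ_{k=0}^{i} x_k) − (t0 − Σ_{k=0}^{i} z_k)|`. -/
def dN (n : ℕ) (s0 : ℤ) (x : ℕ → ℤ) (t0 : ℤ) (z : ℕ → ℤ) : ℕ :=
  (Finset.range n).sup fun i =>
    ((s0 - ∑ k ∈ Finset.range (i + 1), x k) -
      (t0 - ∑ k ∈ Finset.range (i + 1), z k)).natAbs

/-- If all pairs in a nonempty set `A ⊆ S × X^n` are within distance `β`
of each other, then they share a common feasible request sequence. -/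
theorem shared_request_of_dist_le (α β n : ℕ) (hα : 1 ≤ α) (hn : 1 ≤ n)
    (A : Set (ℤ × (ℕ → ℤ))) (hA : A.Nonempty)
    (hmem : ∀ p ∈ A, (0 ≤ p.1 ∧ p.1 ≤ (β : ℤ)) ∧ inX α n p.2)
    (hd : ∀ p ∈ A, ∀ q ∈ A, dN n p.1 p.2 q.1 q.2 ≤ β) :
    ∃ y : ℕ → ℤ, ∀ p ∈ A, feasible β n p.1 p.2 y := by
  classical
  have key : ∀ i : ℕ, ∃ c : ℤ, (i = 0 → c = 0) ∧ (i ≤ n → ∀ p ∈ A,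
      0 ≤ p.1 - (∑ k ∈ Finset.range i, p.2 k) + c ∧
      p.1 - (∑ k ∈ Finset.range i, p.2 k) + c ≤ (β : ℤ)) := by
    intro i
    rcases Nat.eq_zero_or_pos i with rfl | hi
    · refine ⟨0, fun _ => rfl, fun _ p hp => ?_⟩
      have := (hmem p hp).1
      simpa using this
    · by_cases hin : i ≤ n
      · have hdist : ∀ p ∈ A, ∀ q ∈ A,
            (p.1 - ∑ k ∈ Finset.range i, p.2 k) - (q.1 - ∑ k ∈ Finset.range i, q.2 k)
              ≤ (β : ℤ) := by
          intro p hp q hq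
          have h1 := hd p hp q hq
          unfold dN at h1
          rw [Finset.sup_le_iff] at h1
          have h2 := h1 (i - 1) (Finset.mem_range.2 (by omega))
          rw [Nat.sub_add_cancel hi] at h2
          omega
        obtain ⟨p0, hp0⟩ := hA
        obtain ⟨m, ⟨q, hq, hqm⟩, hmin⟩ := Int.exists_least_of_bdd
          (P := fun z => ∃ p ∈ A, p.1 - ∑ k ∈ Finset.range i, p.2 k = z)
          ⟨p0.1 - (∑ k ∈ Finset.range i, p0.2 k) - β, by
            rintro z ⟨p, hp, rfl⟩
            have := hdist p0 hp0 p hp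
            omega⟩
          ⟨_, p0, hp0, rfl⟩
        refine ⟨-m, by omega, fun _ p hp => ?_⟩
        have h1 := hmin _ ⟨p, hp, rfl⟩
        have h2 := hdist p hp q hq
        constructor <;> omega
      · exact ⟨0, fun _ => rfl, fun h => absurd h hin⟩
  choose c hc0 hc using key
  refine ⟨fun k => c (k + 1) - c k, fun p hp i hi => ?_⟩
  have h := hc i hi p hp
  have h0 := hc0 0 rfl
  unfold battState
  rw [Finset.sum_range_sub, h0]
  constructor <;> omega
end

section
/- Let A be a nonempty subset of S × X^n. If there exists a single sequence y ∈ ℤ^n with y ∈ Y^n(s0,x) for every (s0,x) ∈ A, then d_n((s0,x),(ŝ0,x̂)) ≤ β for all (s0,x),(ŝ0,x̂) ∈ A. Equivalently, if two input pairs (s0,x),(ŝ0,x̂) ∈ S × X^n satisfy d_n((s0,x),(ŝ0,x̂)) > β, then Y^n(s0,x) ∩ Y^n(ŝ0,x̂) = ∅. -/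
/-- A shared feasible request bounds the distance. -/
theorem dN_le_of_feasible (β n : ℕ) (s0 t0 : ℤ) (x z y : ℕ → ℤ)
    (h1 : feasible β n s0 x y) (h2 : feasible β n t0 z y) : dN n s0 x t0 z ≤ β := by
  unfold dN
  refine Finset.sup_le fun i hi => ?_
  have hi' : i + 1 ≤ n := Finset.mem_range.mp hi
  have a := h1 (i + 1) hi'
  have b := h2 (i + 1) hi'
  unfold battState at a b
  omega

/-- If all pairs in a nonempty set `A ⊆ S × X^n` share a common feasible
request sequence, then any two of them are within distance `β`. Equivalently, two input
pairs at distance greater than `β` have disjoint feasible request sets. -/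
theorem dist_le_of_shared_request (α β n : ℕ) (hα : 1 ≤ α) (hn : 1 ≤ n)
    (A : Set (ℤ × (ℕ → ℤ))) (hA : A.Nonempty)
    (hmem : ∀ p ∈ A, (0 ≤ p.1 ∧ p.1 ≤ (β : ℤ)) ∧ inX α n p.2) :
    ((∃ y : ℕ → ℤ, ∀ p ∈ A, feasible β n p.1 p.2 y) →
      ∀ p ∈ A, ∀ q ∈ A, dN n p.1 p.2 q.1 q.2 ≤ β) ∧
    (∀ s0 t0 : ℤ, ∀ x z : ℕ → ℤ,
      (0 ≤ s0 ∧ s0 ≤ (β : ℤ)) → inX α n x →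
      (0 ≤ t0 ∧ t0 ≤ (β : ℤ)) → inX α n z →
      β < dN n s0 x t0 z →
      ∀ y : ℕ → ℤ, ¬ (feasible β n s0 x y ∧ feasible β n t0 z y)) := by
  constructor
  · rintro ⟨y, hy⟩ p hp q hq
    exact dN_le_of_feasible β n _ _ _ _ y (hy p hp) (hy q hq)
  · rintro s0 t0 x z _ _ _ _ hd y ⟨h1, h2⟩
    exact absurd (dN_le_of_feasible β n s0 t0 x z y h1 h2) (not_le.mpr hd)
end

section
/- Let A be a nonempty subset of S × X^n such that d_n((s0,x),(ŝ0,x̂)) ≤ β for all (s0,x),(ŝ0,x̂) ∈ A. Define y ∈ ℤ^n by requiring, for every i ∈ {0,…,n−1}, that Σ_{k=0}^{i} y_k = − min over (s0,x) ∈ A of (s0 − Σ_{k=0}^{i} x_k). Then this y is well defined (its prescribed partial sums determine integer entries) and satisfies y ∈ Y^n(s0,x) for every (s0,x) ∈ A. -/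
/-- The explicit shared request sequence: the `y` whose partial sums satisfy
`Σ_{k=0}^{i} y_k = − min over (s0,x) ∈ A of (s0 − Σ_{k=0}^{i} x_k)` is well defined
(exists) and is a feasible request for every input pair in `A`. -/
theorem explicit_shared_request (α β n : ℕ) (hα : 1 ≤ α) (hn : 1 ≤ n)
    (A : Set (ℤ × (ℕ → ℤ))) (hA : A.Nonempty)
    (hmem : ∀ p ∈ A, (0 ≤ p.1 ∧ p.1 ≤ (β : ℤ)) ∧ inX α n p.2)
    (hd : ∀ p ∈ A, ∀ q ∈ A, dN n p.1 p.2 q.1 q.2 ≤ β) :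
    ∃ y : ℕ → ℤ,
      (∀ i < n, ∑ k ∈ Finset.range (i + 1), y k =
        - sInf {z : ℤ | ∃ p ∈ A, z = p.1 - ∑ k ∈ Finset.range (i + 1), p.2 k}) ∧
      ∀ p ∈ A, feasible β n p.1 p.2 y := by
  classical
  let B : ℕ → Set ℤ := fun j => {z : ℤ | ∃ p ∈ A, z = p.1 - ∑ k ∈ Finset.range j, p.2 k}
  let F : ℕ → ℤ := fun j => if j = 0 then 0 else - sInf (B j)
  have hsum : ∀ j, ∑ k ∈ Finset.range j, (F (k + 1) - F k) = F j := by
    intro j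
    rw [Finset.sum_range_sub]
    simp [F]
  refine ⟨fun k => F (k + 1) - F k, ?_, ?_⟩
  · intro i _
    rw [hsum]
    simp [F, B]
  · intro p hp i hi
    unfold battState
    rw [hsum]
    rcases i with _ | i
    · simpa [F] using (hmem p hp).1
    · have hF : F (i + 1) = - sInf (B (i + 1)) := by simp [F]
      rw [hF]
      have hdist : ∀ q ∈ A, ((p.1 - ∑ k ∈ Finset.range (i + 1), p.2 k) -
          (q.1 - ∑ k ∈ Finset.range (i + 1), q.2 k)).natAbs ≤ β := by
        intro q hq
        have h1 := hd p hp q hq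
        unfold dN at h1
        exact (Finset.sup_le_iff.mp h1) i (Finset.mem_range.mpr (by omega))
      have hpB : (p.1 - ∑ k ∈ Finset.range (i + 1), p.2 k) ∈ B (i + 1) := ⟨p, hp, rfl⟩
      have hbdd : BddBelow (B (i + 1)) := by
        refine ⟨(p.1 - ∑ k ∈ Finset.range (i + 1), p.2 k) - β, ?_⟩
        rintro z ⟨q, hq, rfl⟩
        have := hdist q hq
        omega
      have hle := csInf_le hbdd hpB
      obtain ⟨q, hq, hqe⟩ := Int.csInf_mem ⟨_, hpB⟩ hbdd
      have := hdist q hq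
      constructor <;> omega
end

section
/- Covering theorem: assume α ≤ β + 1, let λ = ⌊(β+1)/α⌋, let S0 ⊆ S be nonempty with maximum s̄ and minimum s̲, and let l = ⌊(β + s̲ − s̄)/α⌋; assume n ≥ l. Then there exists a finite set V ⊆ ℤ^n of request sequences with cardinality |V| ≤ 2^{⌈(n − l)/λ⌉} such that for every input pair (s0,x) ∈ S0 × X^n one has Y^n(s0,x) ∩ V ≠ ∅, i.e., at least one sequence of V is feasible for every input pair. -/
def extSeq (N : ℕ) (c : ℤ) (v : ℕ → ℤ) : ℕ → ℤ := fun k => if k < N then v k else c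

theorem batt_ext_le (N : ℕ) (c s0 : ℤ) (x v : ℕ → ℤ) (i : ℕ) (hi : i ≤ N) :
    battState s0 x (extSeq N c v) i = battState s0 x v i := by
  unfold battState
  have : ∑ k ∈ Finset.range i, extSeq N c v k = ∑ k ∈ Finset.range i, v k := by
    apply Finset.sum_congr rfl
    intro k hk
    have := Finset.mem_range.1 hk
    simp only [extSeq]
    rw [if_pos (by omega)]
  rw [this]

theorem batt_ext_add (N : ℕ) (c s0 : ℤ) (x v : ℕ → ℤ) (i : ℕ) :
    battState s0 x (extSeq N c v) (N + i) =
      battState s0 x v N + c * i - ∑ k ∈ Finset.range i, x (N + k) := by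
  rw [← batt_ext_le N c s0 x v N le_rfl]
  unfold battState
  rw [Finset.sum_range_add, Finset.sum_range_add]
  have : ∑ k ∈ Finset.range i, extSeq N c v (N + k) = c * i := by
    simp [extSeq, mul_comm]
  rw [this]
  ring

theorem sum_bd (α : ℕ) (x : ℕ → ℤ) (hx : ∀ k, 0 ≤ x k ∧ x k ≤ (α : ℤ)) (N i : ℕ) :
    0 ≤ ∑ k ∈ Finset.range i, x (N + k) ∧ ∑ k ∈ Finset.range i, x (N + k) ≤ α * i := by
  constructor
  · exact Finset.sum_nonneg fun k _ => (hx _).1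
  · have := Finset.sum_le_card_nsmul (Finset.range i) (fun k => x (N + k)) α
      (fun k _ => (hx _).2)
    simpa [mul_comm] using this

theorem step_cover (α β N lam : ℕ) (hlam : α * lam ≤ β + 1) (S0 : Finset ℤ)
    (V : Finset (ℕ → ℤ))
    (h : ∀ s0 ∈ S0, ∀ x : ℕ → ℤ, (∀ k, 0 ≤ x k ∧ x k ≤ (α : ℤ)) →
      ∃ v ∈ V, feasible β N s0 x v) :
    ∃ V' : Finset (ℕ → ℤ), V'.card ≤ 2 * V.card ∧
      ∀ s0 ∈ S0, ∀ x : ℕ → ℤ, (∀ k, 0 ≤ x k ∧ x k ≤ (α : ℤ)) →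
        ∃ v ∈ V', feasible β (N + lam) s0 x v := by
  classical
  refine ⟨V.image (extSeq N 0) ∪ V.image (extSeq N α), ?_, ?_⟩
  · have h1 := Finset.card_union_le (V.image (extSeq N 0)) (V.image (extSeq N α))
    have h2 : (V.image (extSeq N 0)).card ≤ V.card := Finset.card_image_le
    have h3 : (V.image (extSeq N α)).card ≤ V.card := Finset.card_image_le
    omega
  · intro s0 hs x hx
    obtain ⟨v, hv, hf⟩ := h s0 hs x hx
    have hN := hf N le_rfl
    have hlam' : (α : ℤ) * lam ≤ β + 1 := by exact_mod_cast hlam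
    have key : ∀ j ≤ lam, ∑ k ∈ Finset.range lam, x (N + k) =
        ∑ k ∈ Finset.range j, x (N + k) +
        ∑ k ∈ Finset.range (lam - j), x (N + j + k) := by
      intro j hj
      obtain ⟨d, rfl⟩ := Nat.exists_eq_add_of_le hj
      rw [Finset.sum_range_add]
      simp [add_assoc]
    by_cases hc : 0 ≤ battState s0 x v N - ∑ k ∈ Finset.range lam, x (N + k)
    · refine ⟨extSeq N 0 v, Finset.mem_union_left _ (Finset.mem_image_of_mem _ hv), ?_⟩
      intro i hi
      rcases le_total i N with hiN | hiN
      · rw [batt_ext_le _ _ _ _ _ _ hiN]; exact hf i hiN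
      · obtain ⟨j, rfl⟩ := Nat.exists_eq_add_of_le hiN
        rw [batt_ext_add]
        have hk := key j (by omega)
        have b1 := sum_bd α x hx N j
        have b2 := sum_bd α x hx (N + j) (lam - j)
        constructor <;> linarith
    · refine ⟨extSeq N α v, Finset.mem_union_right _ (Finset.mem_image_of_mem _ hv), ?_⟩
      intro i hi
      rcases le_total i N with hiN | hiN
      · rw [batt_ext_le _ _ _ _ _ _ hiN]; exact hf i hiN
      · obtain ⟨j, rfl⟩ := Nat.exists_eq_add_of_le hiN
        rw [batt_ext_add]
        have hj : j ≤ lam := by omega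
        have hk := key j hj
        have b1 := sum_bd α x hx N j
        have b2 := sum_bd α x hx (N + j) (lam - j)
        rw [Nat.cast_sub hj, mul_sub] at b2
        push Not at hc
        have : battState s0 x v N + 1 ≤ ∑ k ∈ Finset.range lam, x (N + k) := by omega
        constructor <;> linarith

theorem covering (α β n : ℕ) (hα : 1 ≤ α) (hαβ : α ≤ β + 1) (hn : 1 ≤ n)
    (S0 : Finset ℤ) (hS0 : S0.Nonempty)
    (hS0sub : ∀ s ∈ S0, 0 ≤ s ∧ s ≤ (β : ℤ)) :
    let lam := (β + 1) / α
    let l := ((β : ℤ) + S0.min' hS0 - S0.max' hS0).toNat / α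
    n ≥ l →
    ∃ V : Set (ℕ → ℤ), V.Finite ∧
      Nat.card V ≤ 2 ^ ((n - l + lam - 1) / lam) ∧
      ∀ s0 ∈ S0, ∀ x : ℕ → ℤ, inX α n x → ∃ v ∈ V, feasible β n s0 x v := by
  intro lam l hnl
  have hlam : α * lam ≤ β + 1 := Nat.mul_div_le _ _
  have hlampos : 0 < lam := Nat.div_pos hαβ hα
  have hl : α * l ≤ ((β : ℤ) + S0.min' hS0 - S0.max' hS0).toNat := Nat.mul_div_le _ _
  have hmin := hS0sub _ (S0.min'_mem hS0)
  have hmax := hS0sub _ (S0.max'_mem hS0)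
  have hl' : (α : ℤ) * l ≤ (β : ℤ) + S0.min' hS0 - S0.max' hS0 := by
    have h1 : ((α * l : ℕ) : ℤ) ≤ _ := Int.ofNat_le.2 hl
    rw [Int.toNat_of_nonneg (by omega)] at h1
    exact_mod_cast h1
  have main : ∀ K : ℕ, ∃ V : Finset (ℕ → ℤ), V.card ≤ 2 ^ K ∧
      ∀ s0 ∈ S0, ∀ x : ℕ → ℤ, (∀ k, 0 ≤ x k ∧ x k ≤ (α : ℤ)) →
        ∃ v ∈ V, feasible β (l + lam * K) s0 x v := by
    intro K
    induction K with
    | zero =>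
      refine ⟨{fun k => if k = 0 then (β : ℤ) - S0.max' hS0 else 0}, by simp, ?_⟩
      intro s0 hs x hx
      refine ⟨_, Finset.mem_singleton_self _, ?_⟩
      intro i hi
      have h1 := S0.min'_le s0 hs
      have h2 := S0.le_max' s0 hs
      have h3 := hS0sub s0 hs
      have b := sum_bd α x hx 0 i
      simp only [zero_add] at b
      have hi' : (α : ℤ) * i ≤ α * l := by
        have : i ≤ l := by simpa using hi
        gcongr
      unfold battState
      cases i with
      | zero => simpa using h3
      | succ i =>
        have : ∑ k ∈ Finset.range (i + 1),
            (if k = 0 then (β : ℤ) - S0.max' hS0 else 0) = β - S0.max' hS0 := by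
          simp
        rw [this]
        constructor <;> linarith
    | succ K ih =>
      obtain ⟨V, hV, h⟩ := ih
      obtain ⟨V', hV', h'⟩ := step_cover α β _ lam hlam S0 V h
      refine ⟨V', by rw [pow_succ]; omega, ?_⟩
      have e : l + lam * (K + 1) = l + lam * K + lam := by ring
      rw [e]
      exact h'
  obtain ⟨V, hV, h⟩ := main ((n - l + lam - 1) / lam)
  refine ⟨V, V.finite_toSet, by simpa using hV, ?_⟩
  intro s0 hs x hx
  obtain ⟨v, hv, hf⟩ := h s0 hs (fun k => if k < n then x k else 0) (by
    intro k
    by_cases hk : k < n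
    · simpa [hk] using hx k hk
    · simp [hk])
  refine ⟨v, hv, ?_⟩
  intro i hi
  have hle : i ≤ l + lam * ((n - l + lam - 1) / lam) := by
    have h1 := Nat.div_add_mod (n - l + lam - 1) lam
    have h2 := Nat.mod_lt (n - l + lam - 1) hlampos
    omega
  have := hf i hle
  have e : ∑ k ∈ Finset.range i, (if k < n then x k else 0) = ∑ k ∈ Finset.range i, x k := by
    apply Finset.sum_congr rfl
    intro k hk
    have := Finset.mem_range.1 hk
    rw [if_pos (by omega)]
  unfold battState at this ⊢
  rw [e] at this
  exact this
end

section
/- Let S0 ⊆ S be nonempty with maximum s̄ and minimum s̲, and let l = ⌊(β + s̲ − s̄)/α⌋ with l ≥ 1. Then any two input pairs (s0,x),(ŝ0,x̂) ∈ S0 × X^l satisfy d_l((s0,x),(ŝ0,x̂)) ≤ s̄ − (s̲ − lα) ≤ β; consequently all input pairs in S0 × X^l share a common feasible request sequence. -/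
theorem sum_bounds_aux (α n : ℕ) (x : ℕ → ℤ) (hx : inX α n x) (i : ℕ) (hi : i ≤ n) :
    0 ≤ ∑ k ∈ Finset.range i, x k ∧ ∑ k ∈ Finset.range i, x k ≤ (n : ℤ) * (α : ℤ) := by
  constructor
  · exact Finset.sum_nonneg fun k hk => (hx k (by have := Finset.mem_range.1 hk; omega)).1
  · have h : ∑ k ∈ Finset.range i, x k ≤ ∑ _k ∈ Finset.range i, (α : ℤ) :=
      Finset.sum_le_sum fun k hk => (hx k (by have := Finset.mem_range.1 hk; omega)).2
    simp only [Finset.sum_const, Finset.card_range, nsmul_eq_mul] at h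
    have h2 : (i : ℤ) * (α : ℤ) ≤ (n : ℤ) * (α : ℤ) := by
      have : (i : ℤ) ≤ n := by exact_mod_cast hi
      gcongr
    linarith

/-- With `l = ⌊(β + min S0 − max S0)/α⌋ ≥ 1`, any two input pairs in
`S0 × X^l` are at distance at most `max S0 − (min S0 − lα) ≤ β`, and hence all input
pairs in `S0 × X^l` share a common feasible request sequence. -/
theorem first_block_distance_bound (α β : ℕ) (hα : 1 ≤ α)
    (S0 : Finset ℤ) (hS0 : S0.Nonempty)
    (hS0sub : ∀ s ∈ S0, 0 ≤ s ∧ s ≤ (β : ℤ)) :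
    let smax := S0.max' hS0
    let smin := S0.min' hS0
    let l := ((β : ℤ) + smin - smax).toNat / α
    1 ≤ l →
    (smax - (smin - (l : ℤ) * (α : ℤ)) ≤ (β : ℤ)) ∧
    (∀ s0 ∈ S0, ∀ t0 ∈ S0, ∀ x z : ℕ → ℤ, inX α l x → inX α l z →
      (dN l s0 x t0 z : ℤ) ≤ smax - (smin - (l : ℤ) * (α : ℤ))) ∧
    (∃ y : ℕ → ℤ, ∀ s0 ∈ S0, ∀ x : ℕ → ℤ, inX α l x → feasible β l s0 x y) := by
  intro smax smin l hl
  have hmax : ∀ s ∈ S0, s ≤ smax := fun s hs => S0.le_max' s hs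
  have hmin : ∀ s ∈ S0, smin ≤ s := fun s hs => S0.min'_le s hs
  have hkey : smax - (smin - (l : ℤ) * (α : ℤ)) ≤ (β : ℤ) := by
    have h1 : l * α ≤ ((β : ℤ) + smin - smax).toNat := Nat.div_mul_le_self _ _
    have h3 : 1 ≤ l * α := Nat.mul_pos hl hα
    have h2 : ((l * α : ℕ) : ℤ) = (l : ℤ) * (α : ℤ) := by push_cast; rfl
    rw [← h2]
    omega
  clear_value l smax smin
  refine ⟨hkey, ?_, ?_⟩
  · intro s0 hs t0 ht x z hx hz
    have hs1 := hmax s0 hs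
    have hs2 := hmin s0 hs
    have ht1 := hmax t0 ht
    have ht2 := hmin t0 ht
    have hnn : 0 ≤ smax - (smin - (l : ℤ) * (α : ℤ)) := by
      have : 0 ≤ (l : ℤ) * (α : ℤ) := by positivity
      linarith
    have : dN l s0 x t0 z ≤ (smax - (smin - (l : ℤ) * (α : ℤ))).toNat := by
      unfold dN
      apply Finset.sup_le
      intro i hi
      have hi' : i + 1 ≤ l := Finset.mem_range.1 hi
      have a := sum_bounds_aux α l x hx (i + 1) hi'
      have b := sum_bounds_aux α l z hz (i + 1) hi'
      generalize (∑ k ∈ Finset.range (i + 1), x k) = A at *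
      generalize (∑ k ∈ Finset.range (i + 1), z k) = B at *
      generalize (l : ℤ) * (α : ℤ) = C at *
      omega
    omega
  · refine ⟨fun k => if k = 0 then (β : ℤ) - smax else 0, ?_⟩
    intro s0 hs x hx i hi
    have hs1 := hmax s0 hs
    have hs2 := hmin s0 hs
    have hs3 := hS0sub s0 hs
    have a := sum_bounds_aux α l x hx i hi
    unfold battState
    rcases Nat.eq_zero_or_pos i with h0 | h0
    · subst h0
      simpa using hs3
    · have : (∑ k ∈ Finset.range i, if k = 0 then (β : ℤ) - smax else 0) = (β : ℤ) - smax := by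
        rw [Finset.sum_ite_eq' (Finset.range i) 0 (fun _ => (β : ℤ) - smax)]
        simp [h0]
      rw [this]
      constructor <;> linarith
end

section
/- Assume α ≤ β + 1 and let λ = ⌊(β+1)/α⌋. Define A1 = {(s0,x) ∈ S × X^λ : s0 − Σ_{k=0}^{λ−1} x_k ∈ {0,…,β}} and A2 = {(s0,x) ∈ S × X^λ : s0 − Σ_{k=0}^{λ−1} x_k ∈ {−λα,…,−1}}. Then A1 ∪ A2 = S × X^λ, and within each of A1 and A2 every two input pairs are at distance d_λ at most β; consequently there exist sequences y1, y2 ∈ ℤ^λ such that y1 is feasible for every input pair in A1 and y2 is feasible for every input pair in A2. -/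
lemma partial_bounds (α : ℕ) (x : ℕ → ℤ) (m : ℕ) : ∀ i j : ℕ, i + j = m → inX α m x →
    0 ≤ (∑ k ∈ Finset.range m, x k) - ∑ k ∈ Finset.range i, x k ∧
    (∑ k ∈ Finset.range m, x k) - ∑ k ∈ Finset.range i, x k ≤ (j : ℤ) * α := by
  intro i j
  induction j generalizing m with
  | zero => intro h _; subst h; simp
  | succ j ih =>
    intro h hx
    subst h
    have h1 := ih (i + j) rfl (fun k hk => hx k (by omega))
    have h2 := hx (i + j) (by omega)
    rw [← add_assoc, Finset.sum_range_succ]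
    push_cast
    constructor <;> nlinarith

lemma all_bounds {α n : ℕ} {x : ℕ → ℤ} (hx : inX α n x) {i : ℕ} (hi : i ≤ n) :
    0 ≤ (∑ k ∈ Finset.range i, x k) ∧ (∑ k ∈ Finset.range i, x k) ≤ (i : ℤ) * α ∧
    (∑ k ∈ Finset.range i, x k) ≤ (∑ k ∈ Finset.range n, x k) ∧
    (∑ k ∈ Finset.range n, x k) - (∑ k ∈ Finset.range i, x k) ≤ (n : ℤ) * α - (i : ℤ) * α := by
  have h1 := partial_bounds α x n i (n - i) (by omega) hx
  have h2 := partial_bounds α x i 0 i (by omega) (fun k hk => hx k (by omega))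
  rw [Nat.cast_sub hi, sub_mul] at h1
  simp only [Finset.range_zero, Finset.sum_empty, sub_zero] at h2
  refine ⟨h2.1, h2.2, by linarith [h1.1], h1.2⟩

/-- With `lam = ⌊(β+1)/α⌋`, the sets `A1` (battery does not deplete during
the block) and `A2` (battery depletes) cover `S × X^lam`, within each set the distance
between any two pairs is at most `β`, and hence each set admits a common feasible
request sequence. -/
theorem two_set_cover (α β : ℕ) (hα : 1 ≤ α) (hαβ : α ≤ β + 1) :
    let lam := (β + 1) / α
    let A1 : Set (ℤ × (ℕ → ℤ)) :=
      {p | (0 ≤ p.1 ∧ p.1 ≤ (β : ℤ)) ∧ inX α lam p.2 ∧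
        0 ≤ p.1 - ∑ k ∈ Finset.range lam, p.2 k ∧
        p.1 - ∑ k ∈ Finset.range lam, p.2 k ≤ (β : ℤ)}
    let A2 : Set (ℤ × (ℕ → ℤ)) :=
      {p | (0 ≤ p.1 ∧ p.1 ≤ (β : ℤ)) ∧ inX α lam p.2 ∧
        -((lam : ℤ) * (α : ℤ)) ≤ p.1 - ∑ k ∈ Finset.range lam, p.2 k ∧
        p.1 - ∑ k ∈ Finset.range lam, p.2 k ≤ -1}
    (∀ p : ℤ × (ℕ → ℤ), (0 ≤ p.1 ∧ p.1 ≤ (β : ℤ)) → inX α lam p.2 →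
      p ∈ A1 ∪ A2) ∧
    (∀ p ∈ A1, ∀ q ∈ A1, dN lam p.1 p.2 q.1 q.2 ≤ β) ∧
    (∀ p ∈ A2, ∀ q ∈ A2, dN lam p.1 p.2 q.1 q.2 ≤ β) ∧
    (∃ y1 : ℕ → ℤ, ∀ p ∈ A1, feasible β lam p.1 p.2 y1) ∧
    (∃ y2 : ℕ → ℤ, ∀ p ∈ A2, feasible β lam p.1 p.2 y2) := by
  intro lam A1 A2
  have hl : (lam : ℤ) * α ≤ β + 1 := by exact_mod_cast Nat.div_mul_le_self (β + 1) α
  refine ⟨?_, ?_, ?_, ⟨fun _ => 0, ?_⟩, ⟨fun _ => (α : ℤ), ?_⟩⟩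
  · intro p hp hx
    have h := all_bounds hx le_rfl
    by_cases h0 : 0 ≤ p.1 - ∑ k ∈ Finset.range lam, p.2 k
    · left
      exact ⟨hp, hx, h0, by linarith [hp.2]⟩
    · right
      exact ⟨hp, hx, by linarith [hp.1], by omega⟩
  · rintro p ⟨hp, hpx, hp0, hp1⟩ q ⟨hq, hqx, hq0, hq1⟩
    refine Finset.sup_le fun i hi => ?_
    have hi' : i + 1 ≤ lam := Finset.mem_range.mp hi
    have h1 := all_bounds hpx hi'
    have h2 := all_bounds hqx hi'
    omega
  · rintro p ⟨hp, hpx, hp0, hp1⟩ q ⟨hq, hqx, hq0, hq1⟩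
    refine Finset.sup_le fun i hi => ?_
    have hi' : i + 1 ≤ lam := Finset.mem_range.mp hi
    have h1 := all_bounds hpx hi'
    have h2 := all_bounds hqx hi'
    generalize ((i + 1 : ℕ) : ℤ) * (α : ℤ) = u at *
    generalize (lam : ℤ) * (α : ℤ) = v at *
    omega
  · rintro p ⟨hp, hpx, hp0, hp1⟩ i hi
    have h1 := all_bounds hpx hi
    simp only [battState, Finset.sum_const_zero]
    constructor <;> linarith
  · rintro p ⟨hp, hpx, hp0, hp1⟩ i hi
    have h1 := all_bounds hpx hi
    simp only [battState, Finset.sum_const, Finset.card_range, nsmul_eq_mul]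
    constructor <;> linarith
end

section
/- Packing theorem: let m = ⌈(β+1)/α⌉, let l ≥ 1, let s0 ∈ S, and let S_l ⊆ S be a nonempty interval of consecutive integers (the allowed final battery states). Set κ̂ = max(0, ⌊l/m⌋ − 1). Then there exists a set W ⊆ X^l of consumption sequences with cardinality |W| ≥ 2^{κ̂} · ⌈(lα − κ̂ m α)/|S_l|⌉ such that for any two distinct w, ŵ ∈ W the constrained feasible sets are disjoint: {y ∈ Y^l(s0,w) : battery state s_l under (s0,w,y) lies in S_l} ∩ {y ∈ Y^l(s0,ŵ) : battery state s_l under (s0,ŵ,y) lies in S_l} = ∅. -/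
/-- Codeword with block pattern `b` and tail total `t`. -/
def pkWord (α m K l : ℕ) (b : Finset ℕ) (t : ℕ) (k : ℕ) : ℤ :=
  if k < K * m then (if k / m ∈ b then (α : ℤ) else 0)
  else if k < l then ((min α (t - (k - K * m) * α) : ℕ) : ℤ) else 0

lemma pk_tail (α t n : ℕ) :
    ∑ i ∈ Finset.range n, ((min α (t - i * α) : ℕ) : ℤ) = ((min (n * α) t : ℕ) : ℤ) := by
  induction n with
  | zero => simp
  | succ n ih =>
    rw [Finset.sum_range_succ, ih, add_mul, one_mul]
    generalize n * α = z
    omega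

lemma pk_block (α m K l : ℕ) (hm : 0 < m) (b : Finset ℕ) (t q : ℕ) (hq : q < K) :
    ∑ k ∈ Finset.range ((q + 1) * m), pkWord α m K l b t k =
      ∑ k ∈ Finset.range (q * m), pkWord α m K l b t k
        + (if q ∈ b then (m : ℤ) * α else 0) := by
  rw [add_mul, one_mul, Finset.sum_range_add]
  congr 1
  have : ∀ x ∈ Finset.range m, pkWord α m K l b t (q * m + x) = if q ∈ b then (α : ℤ) else 0 := by
    intro x hx
    have hx := Finset.mem_range.1 hx
    have h1 : q * m + x < K * m := by nlinarith
    have h2 : (q * m + x) / m = q := by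
      rw [mul_comm, Nat.mul_add_div hm, Nat.div_eq_of_lt hx, add_zero]
    simp [pkWord, h1, h2]
  rw [Finset.sum_congr rfl this]
  split_ifs <;> simp

lemma pk_prefix (α m K l : ℕ) (b b' : Finset ℕ) (t t' q : ℕ) (hq : q ≤ K)
    (h : ∀ p < q, (p ∈ b ↔ p ∈ b')) :
    ∑ k ∈ Finset.range (q * m), pkWord α m K l b t k =
      ∑ k ∈ Finset.range (q * m), pkWord α m K l b' t' k := by
  apply Finset.sum_congr rfl
  intro k hk
  have hk := Finset.mem_range.1 hk
  have h1 : k < K * m := hk.trans_le (Nat.mul_le_mul_right _ hq)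
  have h2 : k / m < q := Nat.div_lt_of_lt_mul (by rwa [mul_comm] at hk)
  simp [pkWord, h1, h _ h2]

lemma pk_total (α m K l : ℕ) (hK : K * m ≤ l) (b : Finset ℕ) (t : ℕ)
    (ht : t ≤ (l - K * m) * α) :
    ∑ k ∈ Finset.range l, pkWord α m K l b t k =
      ∑ k ∈ Finset.range (K * m), pkWord α m K l b t k + t := by
  obtain ⟨n, rfl⟩ := Nat.exists_eq_add_of_le hK
  rw [Finset.sum_range_add]
  congr 1
  have : ∀ x ∈ Finset.range n, pkWord α m K (K * m + n) b t (K * m + x)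
      = ((min α (t - x * α) : ℕ) : ℤ) := by
    intro x hx
    have hx := Finset.mem_range.1 hx
    simp [pkWord, hx]
  rw [Finset.sum_congr rfl this, pk_tail]
  rw [Nat.add_sub_cancel_left] at ht
  rw [min_eq_right ht]

lemma pk_sep (α β m K l c R : ℕ) (hm : 0 < m) (hb : β + 1 ≤ m * α) (hK : K * m ≤ l)
    (hR : ∀ j < R, j * c ≤ (l - K * m) * α)
    (b b' : Finset ℕ) (hbK : b ⊆ Finset.range K) (hbK' : b' ⊆ Finset.range K)
    (j j' : ℕ) (hj : j < R) (hj' : j' < R) (hne : (b, j) ≠ (b', j')) :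
    (∃ i ≤ l, (β : ℤ) + 1 ≤ |∑ k ∈ Finset.range i, pkWord α m K l b (j * c) k
        - ∑ k ∈ Finset.range i, pkWord α m K l b' (j' * c) k|) ∨
    (c : ℤ) ≤ |∑ k ∈ Finset.range l, pkWord α m K l b (j * c) k
        - ∑ k ∈ Finset.range l, pkWord α m K l b' (j' * c) k| := by
  classical
  by_cases hbb : b = b'
  · right
    subst hbb
    have hjj : j ≠ j' := fun h => hne (by rw [h])
    rw [pk_total α m K l hK b _ (hR j hj), pk_total α m K l hK b _ (hR j' hj'),
      pk_prefix α m K l b b (j * c) (j' * c) K le_rfl (fun _ _ => Iff.rfl)]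
    rw [add_sub_add_left_eq_sub]
    push_cast
    rw [← sub_mul, abs_mul, Nat.abs_cast]
    have : (1 : ℤ) ≤ |(j : ℤ) - j'| := Int.one_le_abs (by omega)
    nlinarith
  · left
    have hex : ∃ q, ¬ (q ∈ b ↔ q ∈ b') := by
      by_contra hcon
      push Not at hcon
      exact hbb (Finset.ext hcon)
    have hq := Nat.find_spec hex
    have hmin : ∀ p < Nat.find hex, (p ∈ b ↔ p ∈ b') := fun p hp => not_not.1 (Nat.find_min hex hp)
    generalize Nat.find hex = q at hq hmin
    have hqK : q < K := by
      by_cases h : q ∈ b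
      · exact Finset.mem_range.1 (hbK h)
      · have h' : q ∈ b' := by tauto
        exact Finset.mem_range.1 (hbK' h')
    refine ⟨(q + 1) * m, (Nat.mul_le_mul_right _ hqK).trans hK, ?_⟩
    rw [pk_block α m K l hm b _ q hqK, pk_block α m K l hm b' _ q hqK,
      pk_prefix α m K l b b' (j * c) (j' * c) q hqK.le hmin, add_sub_add_left_eq_sub]
    have hb2 : (β : ℤ) + 1 ≤ (m : ℤ) * α := by exact_mod_cast hb
    by_cases h : q ∈ b
    · have h' : q ∉ b' := by tauto
      simp only [h, h', if_true, if_false, sub_zero]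
      exact hb2.trans (le_abs_self _)
    · have h' : q ∈ b' := by tauto
      simp only [h, h', if_true, if_false, zero_sub, abs_neg]
      exact hb2.trans (le_abs_self _)

/-- Packing theorem. With `m = ⌈(β+1)/α⌉` and `κ̂ = max(0, ⌊l/m⌋ − 1)`,
there is a set `W` of consumption sequences (supported on the first `l` steps) with
`|W| ≥ 2^κ̂ · ⌈(lα − κ̂mα)/|S_l|⌉` whose constrained feasible request sets (final
battery state in the interval `S_l`) are pairwise disjoint. -/
theorem packing (α β l : ℕ) (hα : 1 ≤ α) (hl : 1 ≤ l)
    (s0 : ℤ) (hs0 : 0 ≤ s0 ∧ s0 ≤ (β : ℤ))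
    (Sl : Finset ℤ) (hSl : Sl.Nonempty)
    (hSlsub : ∀ s ∈ Sl, 0 ≤ s ∧ s ≤ (β : ℤ))
    (hInt : ∃ a b : ℤ, a ≤ b ∧ Sl = Finset.Icc a b) :
    let m := (β + α) / α
    let khat := l / m - 1
    ∃ W : Set (ℕ → ℤ), W.Finite ∧
      (∀ w ∈ W, inX α l w ∧ ∀ k, l ≤ k → w k = 0) ∧
      2 ^ khat * ((l * α - khat * m * α + Sl.card - 1) / Sl.card) ≤ Nat.card W ∧
      ∀ w ∈ W, ∀ w' ∈ W, w ≠ w' →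
        ∀ y : ℕ → ℤ,
          ¬ ((feasible β l s0 w y ∧ battState s0 w y l ∈ Sl) ∧
             (feasible β l s0 w' y ∧ battState s0 w' y l ∈ Sl)) := by
  classical
  intro m K
  obtain ⟨lo, hi, hab, hSeq⟩ := hInt
  have hc : 0 < Sl.card := hSl.card_pos
  have hcard : (Sl.card : ℤ) = hi + 1 - lo := by
    rw [hSeq, Int.card_Icc]; omega
  generalize Sl.card = c at hc hcard ⊢
  have hm : 0 < m := Nat.div_pos (by omega) (by omega)
  have hb : β + 1 ≤ m * α := by
    have h1 := Nat.div_add_mod (β + α) α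
    have h2 := Nat.mod_lt (β + α) (show 0 < α by omega)
    have h3 : m * α = α * ((β + α) / α) := mul_comm _ _
    omega
  have hK : K * m ≤ l :=
    (Nat.mul_le_mul_right _ (Nat.sub_le _ _)).trans (Nat.div_mul_le_self l m)
  clear_value K m
  rw [← Nat.sub_mul]
  set R := ((l - K * m) * α + c - 1) / c with hRdef
  have hR : ∀ j < R, j * c ≤ (l - K * m) * α := by
    intro j hj
    have h1 : R * c ≤ (l - K * m) * α + c - 1 := Nat.div_mul_le_self _ _
    have h2 : (j + 1) * c ≤ R * c := Nat.mul_le_mul_right _ hj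
    rw [add_mul, one_mul] at h2
    omega
  let f : Finset ℕ × ℕ → ℕ → ℤ := fun p => pkWord α m K l p.1 (p.2 * c)
  let D := (Finset.range K).powerset ×ˢ Finset.range R
  have hsep : ∀ p ∈ D, ∀ p' ∈ D, p ≠ p' →
      (∃ i ≤ l, (β : ℤ) + 1 ≤ |∑ k ∈ Finset.range i, f p k - ∑ k ∈ Finset.range i, f p' k|) ∨
      (c : ℤ) ≤ |∑ k ∈ Finset.range l, f p k - ∑ k ∈ Finset.range l, f p' k| := by
    rintro ⟨b, j⟩ hp ⟨b', j'⟩ hp' hne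
    simp only [D, Finset.mem_product, Finset.mem_powerset, Finset.mem_range] at hp hp'
    exact pk_sep α β m K l c R hm hb hK hR b b' hp.1 hp'.1 j j' hp.2 hp'.2 hne
  have hinj : Set.InjOn f D := by
    intro p hp p' hp' heq
    by_contra hne
    rcases hsep p hp p' hp' hne with ⟨i, _, h⟩ | h
    · rw [heq, sub_self, abs_zero] at h; omega
    · rw [heq, sub_self, abs_zero] at h; omega
  refine ⟨((D.image f : Finset (ℕ → ℤ)) : Set (ℕ → ℤ)), Finset.finite_toSet _, ?_, ?_, ?_⟩
  · intro w hw
    obtain ⟨p, hp, rfl⟩ := Finset.mem_image.1 (Finset.mem_coe.1 hw)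
    constructor
    · intro k hk
      simp only [f, pkWord, hk, if_true]
      split_ifs <;> constructor <;> omega
    · intro k hk
      simp only [f, pkWord]
      rw [if_neg (by omega), if_neg (by omega)]
  · rw [Nat.card_coe_set_eq, Set.ncard_coe_finset, Finset.card_image_of_injOn hinj]
    simp [D]
  · intro w hw w' hw' hne y
    obtain ⟨p, hp, rfl⟩ := Finset.mem_image.1 (Finset.mem_coe.1 hw)
    obtain ⟨p', hp', rfl⟩ := Finset.mem_image.1 (Finset.mem_coe.1 hw')
    rintro ⟨⟨h1, h2⟩, h3, h4⟩
    rw [hSeq, Finset.mem_Icc] at h2 h4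
    rcases hsep p hp p' hp' (fun h => hne (by rw [h])) with ⟨i, hi', h⟩ | h
    · have e1 := h1 i hi'
      have e2 := h3 i hi'
      unfold battState at e1 e2
      rcases le_abs.1 h with h | h <;> omega
    · unfold battState at h2 h4
      rcases le_abs.1 h with h | h <;> omega
end

section
/- Let m ≥ 1 be an integer, s0 ∈ S, and let w, ŵ ∈ X^m be consumption sequences whose total consumptions differ by more than the battery capacity, i.e., |Σ_{k=0}^{m−1} w_k − Σ_{k=0}^{m−1} ŵ_k| > β. Then Y^m(s0,w) ∩ Y^m(s0,ŵ) = ∅. In particular, for m = ⌈(β+1)/α⌉, the all-zeros sequence w' and the all-α sequence w'' in X^m satisfy Y^m(s0,w') ∩ Y^m(s0,w'') = ∅. -/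
/-- Two consumption sequences whose total consumptions differ by more than
the battery capacity `β` have disjoint feasible request sets. In particular, for
`m = ⌈(β+1)/α⌉`, the all-zeros and all-`α` sequences of length `m` have disjoint
feasible request sets. -/
theorem disjoint_of_total_consumption_gap (α β m : ℕ) (hα : 1 ≤ α) (hm : 1 ≤ m)
    (s0 : ℤ) (hs0 : 0 ≤ s0 ∧ s0 ≤ (β : ℤ)) :
    (∀ w w' : ℕ → ℤ, inX α m w → inX α m w' →
      (β : ℤ) < |∑ k ∈ Finset.range m, w k - ∑ k ∈ Finset.range m, w' k| →
      ∀ y : ℕ → ℤ, ¬ (feasible β m s0 w y ∧ feasible β m s0 w' y)) ∧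
    (m = (β + α) / α →
      ∀ y : ℕ → ℤ,
        ¬ (feasible β m s0 (fun _ => 0) y ∧ feasible β m s0 (fun _ => (α : ℤ)) y)) := by
  have key : ∀ w w' : ℕ → ℤ,
      (β : ℤ) < |∑ k ∈ Finset.range m, w k - ∑ k ∈ Finset.range m, w' k| →
      ∀ y : ℕ → ℤ, ¬ (feasible β m s0 w y ∧ feasible β m s0 w' y) := by
    rintro w w' h y ⟨h1, h2⟩
    have a := h1 m le_rfl
    have b := h2 m le_rfl
    simp only [battState] at a b
    rcases lt_abs.mp h with h | h <;> linarith [a.1, a.2, b.1, b.2]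
  refine ⟨fun w w' _ _ h => key w w' h, fun hmm => key _ _ ?_⟩
  have h : β < m * α := by
    have h1 := Nat.div_add_mod (β + α) α
    have h2 := Nat.mod_lt (β + α) hα
    rw [← hmm] at h1
    nlinarith
  have h' : (β : ℤ) < m * α := by exact_mod_cast h
  refine lt_abs.mpr (Or.inr ?_)
  simpa using h'
end

section
/- There exists a map F_n : ℤ^n → {0,1,…,α}^n, depending only on n, α and β (not on the input pair), such that for every input pair (s0,x) ∈ S × X^n and every feasible request y ∈ Y^n(s0,x), the transformed sequence satisfies F_n(y) ∈ Y^n(s0,x). In particular, request sequences whose entries lie in {0,…,α} suffice to achieve feasibility. -/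
/-- Zero together with all values `D_i = Σ_{k<i} x_k − s0` over the pairs `(s0,x)` for which `y`
is feasible. -/
def reachSet (α β n : ℕ) (y : ℕ → ℤ) (i : ℕ) : Set ℤ :=
  {d | d = 0 ∨ ∃ s0 : ℤ, ∃ x : ℕ → ℤ, 0 ≤ s0 ∧ s0 ≤ (β : ℤ) ∧ inX α n x ∧ feasible β n s0 x y ∧
    d = (∑ k ∈ Finset.range i, x k) - s0}

theorem reachSet_bdd (α β n : ℕ) (y : ℕ → ℤ) (i : ℕ) (hi : i ≤ n) :
    BddAbove (reachSet α β n y i) := by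
  refine ⟨max 0 (∑ k ∈ Finset.range i, y k), ?_⟩
  rintro d (rfl | ⟨s0, x, _, _, _, hf, rfl⟩)
  · exact le_max_left _ _
  · have h := (hf i hi).1
    unfold battState at h
    exact le_max_of_le_right (by linarith)

theorem reachSet_zero_mem (α β n : ℕ) (y : ℕ → ℤ) (i : ℕ) : (0 : ℤ) ∈ reachSet α β n y i :=
  Or.inl rfl

/-- The partial sums of the transformed sequence. -/
noncomputable def envel (α β n : ℕ) (y : ℕ → ℤ) (i : ℕ) : ℤ := sSup (reachSet α β n y i)

theorem envel_zero (α β n : ℕ) (y : ℕ → ℤ) : envel α β n y 0 = 0 := by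
  apply le_antisymm
  · apply csSup_le ⟨0, reachSet_zero_mem α β n y 0⟩
    rintro d (rfl | ⟨s0, x, h0, _, _, _, rfl⟩)
    · exact le_rfl
    · simpa using h0
  · exact le_csSup (reachSet_bdd α β n y 0 (Nat.zero_le _)) (reachSet_zero_mem α β n y 0)

theorem envel_step (α β n : ℕ) (y : ℕ → ℤ) (i : ℕ) (hi : i < n) :
    envel α β n y i ≤ envel α β n y (i + 1) ∧
      envel α β n y (i + 1) ≤ envel α β n y i + α := by
  have b0 := reachSet_bdd α β n y i hi.le
  have b1 := reachSet_bdd α β n y (i + 1) hi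
  constructor
  · apply csSup_le ⟨0, reachSet_zero_mem α β n y i⟩
    rintro d (rfl | ⟨s0, x, h0, h1, hx, hf, rfl⟩)
    · exact le_csSup b1 (reachSet_zero_mem α β n y (i + 1))
    · have h := le_csSup b1 (Or.inr ⟨s0, x, h0, h1, hx, hf, rfl⟩)
      rw [Finset.sum_range_succ] at h
      have := (hx i hi).1
      unfold envel
      linarith
  · apply csSup_le ⟨0, reachSet_zero_mem α β n y (i + 1)⟩
    rintro d (rfl | ⟨s0, x, h0, h1, hx, hf, rfl⟩)
    · have h := le_csSup b0 (reachSet_zero_mem α β n y i)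
      unfold envel
      have : (0 : ℤ) ≤ α := Int.natCast_nonneg α
      linarith
    · have h := le_csSup b0 (Or.inr ⟨s0, x, h0, h1, hx, hf, rfl⟩)
      rw [Finset.sum_range_succ]
      have := (hx i hi).2
      unfold envel
      linarith

/-- There is a map `F_n : ℤ^n → {0,…,α}^n`, depending only on `n`, `α`
and `β`, such that for every input pair `(s0,x) ∈ S × X^n` and every feasible request
`y`, the transformed sequence `F_n(y)` is also feasible for `(s0,x)`. -/
theorem constrained_alphabet_map (α β n : ℕ) (hα : 1 ≤ α) (hn : 1 ≤ n) :
    ∃ F : (ℕ → ℤ) → (ℕ → ℤ),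
      (∀ y : ℕ → ℤ, ∀ k < n, 0 ≤ F y k ∧ F y k ≤ (α : ℤ)) ∧
      ∀ s0 : ℤ, 0 ≤ s0 → s0 ≤ (β : ℤ) →
        ∀ x : ℕ → ℤ, inX α n x →
          ∀ y : ℕ → ℤ, feasible β n s0 x y → feasible β n s0 x (F y) := by
  refine ⟨fun y k => envel α β n y (k + 1) - envel α β n y k, ?_, ?_⟩
  · intro y k hk
    have h := envel_step α β n y k hk
    constructor <;> dsimp only <;> linarith [h.1, h.2]
  · intro s0 h0 h1 x hx y hf i hi
    unfold battState
    rw [Finset.sum_range_sub, envel_zero]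
    have hl := le_csSup (reachSet_bdd α β n y i hi) (Or.inr ⟨s0, x, h0, h1, hx, hf, rfl⟩)
    have hu : envel α β n y i ≤ β + ((∑ k ∈ Finset.range i, x k) - s0) := by
      apply csSup_le ⟨0, reachSet_zero_mem α β n y i⟩
      rintro d (rfl | ⟨t0, z, _, _, _, hg, rfl⟩)
      · have : 0 ≤ ∑ k ∈ Finset.range i, x k :=
          Finset.sum_nonneg fun k hk => (hx k ((Finset.mem_range.mp hk).trans_le hi)).1
        linarith
      · have a := (hf i hi).2
        have b := (hg i hi).1
        unfold battState at a b
        linarith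
    unfold envel at hu ⊢
    constructor <;> linarith
end

section
/- Forward reallocation preserves feasibility: let (s0,x) ∈ S × X^n, let y ∈ Y^n(s0,x), let i ∈ {0,…,n−2}, and let d be an integer with 0 ≤ d ≤ max(0, y_i − α). Define ỹ by ỹ_i = y_i − d, ỹ_{i+1} = y_{i+1} + d, and ỹ_k = y_k for k ∉ {i, i+1}. Then ỹ ∈ Y^n(s0,x). -/
/-- Forward reallocation preserves feasibility: moving `d` units of
requested energy, with `0 ≤ d ≤ max(0, y_i − α)`, from time step `i ∈ {0,…,n−2}`
to time step `i+1` keeps the request sequence feasible. -/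
theorem forward_reallocation (α β n : ℕ) (hα : 1 ≤ α) (hn : 2 ≤ n)
    (s0 : ℤ) (hs0 : 0 ≤ s0 ∧ s0 ≤ (β : ℤ))
    (x : ℕ → ℤ) (hx : inX α n x)
    (y : ℕ → ℤ) (hy : feasible β n s0 x y)
    (i : ℕ) (hi : i + 2 ≤ n)
    (d : ℤ) (hd0 : 0 ≤ d) (hd1 : d ≤ max 0 (y i - (α : ℤ))) :
    feasible β n s0 x
      (fun k => if k = i then y i - d else if k = i + 1 then y (i + 1) + d else y k) := by
  have key : ∀ j, (∑ k ∈ Finset.range j,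
      (if k = i then y i - d else if k = i + 1 then y (i + 1) + d else y k))
      = (∑ k ∈ Finset.range j, y k) - (if j = i + 1 then d else 0) := by
    intro j
    induction j with
    | zero => simp
    | succ j ih =>
      rw [Finset.sum_range_succ, Finset.sum_range_succ, ih]
      by_cases h1 : j = i
      · subst h1
        simp
        ring
      · by_cases h2 : j = i + 1
        · subst h2
          simp
        · simp [h1, h2]
  intro j hj
  have hj' := hy j hj
  unfold battState at hj' ⊢
  rw [key j]
  by_cases h : j = i + 1
  · subst h
    have h0 := hy i (by omega)
    have hxi := hx i (by omega)
    unfold battState at h0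
    rw [Finset.sum_range_succ, Finset.sum_range_succ] at hj' ⊢
    simp only [if_true]
    omega
  · simpa [h] using hj'
end

section
/- Reallocating energy selling preserves feasibility: let (s0,x) ∈ S × X^n, let y ∈ Y^n(s0,x), let i ∈ {0,…,n−2}, and let d be an integer with 0 ≤ d ≤ max(0, −y_i). Define ỹ by ỹ_i = y_i + d, ỹ_{i+1} = y_{i+1} − d, and ỹ_k = y_k for k ∉ {i, i+1}. Then ỹ ∈ Y^n(s0,x). -/
/-- Reallocating energy selling preserves feasibility: increasing the
request at time step `i ∈ {0,…,n−2}` by `d` with `0 ≤ d ≤ max(0, −y_i)` and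
decreasing the request at time step `i+1` by `d` keeps the request sequence feasible. -/
theorem selling_reallocation (α β n : ℕ) (hα : 1 ≤ α) (hn : 2 ≤ n)
    (s0 : ℤ) (hs0 : 0 ≤ s0 ∧ s0 ≤ (β : ℤ))
    (x : ℕ → ℤ) (hx : inX α n x)
    (y : ℕ → ℤ) (hy : feasible β n s0 x y)
    (i : ℕ) (hi : i + 2 ≤ n)
    (d : ℤ) (hd0 : 0 ≤ d) (hd1 : d ≤ max 0 (-(y i))) :
    feasible β n s0 x
      (fun k => if k = i then y i + d else if k = i + 1 then y (i + 1) - d else y k) := by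
  have key : ∀ m, (∑ k ∈ Finset.range m,
      (if k = i then y i + d else if k = i + 1 then y (i + 1) - d else y k))
      = (∑ k ∈ Finset.range m, y k) + if m = i + 1 then d else 0 := by
    intro m
    induction m with
    | zero => simp
    | succ m ih =>
      rw [Finset.sum_range_succ, Finset.sum_range_succ, ih]
      by_cases h1 : m = i
      · subst h1
        simp
        ring
      · by_cases h2 : m = i + 1
        · subst h2
          simp
        · simp [h1, h2]
  intro m hm
  have hm' := hy m hm
  unfold battState at hm' ⊢
  rw [key m]
  by_cases h : m = i + 1
  · subst h
    have h1 := hy i (by omega)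
    have h2 := hx i (by omega)
    unfold battState at h1
    rw [Finset.sum_range_succ, Finset.sum_range_succ] at hm' ⊢
    simp only [if_true]
    omega
  · simpa [h] using hm'
end

section
/- Covering with a constrained request alphabet: assume α ≤ β + 1, let λ = ⌊(β+1)/α⌋, fix s0 ∈ S, and assume n ≥ ⌊β/α⌋. Then there exists a finite set V ⊆ {0,1,…,α}^n with cardinality |V| ≤ 2^{⌈(n − ⌊β/α⌋)/λ⌉} such that for every consumption sequence x ∈ X^n there is some v ∈ V with v ∈ Y^n(s0,x). -/
/-- Keep `v` before time `N`, request the constant `c` afterwards. -/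
def extReq (N : ℕ) (c : ℤ) (v : ℕ → ℤ) : ℕ → ℤ := fun k => if k < N then v k else c

lemma battState_extReq_lt (s0 : ℤ) (x v : ℕ → ℤ) (N : ℕ) (c : ℤ) (i : ℕ) (hi : i ≤ N) :
    battState s0 x (extReq N c v) i = battState s0 x v i := by
  unfold battState
  have : ∑ k ∈ Finset.range i, extReq N c v k = ∑ k ∈ Finset.range i, v k := by
    apply Finset.sum_congr rfl
    intro k hk
    have := Finset.mem_range.mp hk
    simp [extReq, show k < N by omega]
  rw [this]

lemma battState_extReq_add (s0 : ℤ) (x v : ℕ → ℤ) (N : ℕ) (c : ℤ) (j : ℕ) :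
    battState s0 x (extReq N c v) (N + j)
      = battState s0 x v N + j * c - ∑ k ∈ Finset.range j, x (N + k) := by
  have h := battState_extReq_lt s0 x v N c N le_rfl
  unfold battState at *
  rw [Finset.sum_range_add, Finset.sum_range_add]
  have : ∑ k ∈ Finset.range j, extReq N c v (N + k) = j * c := by
    simp [extReq]
  rw [this]
  linarith

lemma psum_bounds (a : ℤ) (z : ℕ → ℤ) (hz : ∀ k, 0 ≤ z k ∧ z k ≤ a) (j d : ℕ) :
    ∑ k ∈ Finset.range j, z k ≤ ∑ k ∈ Finset.range (j + d), z k ∧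
    ∑ k ∈ Finset.range (j + d), z k ≤ ∑ k ∈ Finset.range j, z k + d * a := by
  induction d with
  | zero => simp
  | succ d ih =>
    rw [← add_assoc, Finset.sum_range_succ]
    have := hz (j + d)
    push_cast
    constructor <;> nlinarith

lemma block_step (a : ℤ) (β N L : ℕ) (hL : (L : ℤ) * a ≤ β + 1) (s0 : ℤ) (x v : ℕ → ℤ)
    (hx : ∀ k, 0 ≤ x k ∧ x k ≤ a) (hv : feasible β N s0 x v) :
    feasible β (N + L) s0 x (extReq N 0 v) ∨ feasible β (N + L) s0 x (extReq N a v) := by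
  have hs := hv N le_rfl
  have key : ∀ c : ℤ, (∀ j ≤ L, 0 ≤ battState s0 x v N + j * c - ∑ k ∈ Finset.range j, x (N + k) ∧
      battState s0 x v N + j * c - ∑ k ∈ Finset.range j, x (N + k) ≤ β) →
      feasible β (N + L) s0 x (extReq N c v) := by
    intro c h i hi
    rcases le_total i N with h1 | h1
    · rw [battState_extReq_lt _ _ _ _ _ _ h1]
      exact hv i h1
    · obtain ⟨j, rfl⟩ := Nat.exists_eq_add_of_le h1
      rw [battState_extReq_add]
      exact h j (by omega)
  have hz : ∀ k, 0 ≤ x (N + k) ∧ x (N + k) ≤ a := fun k => hx _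
  by_cases hc : ∑ k ∈ Finset.range L, x (N + k) ≤ battState s0 x v N
  · left
    apply key
    intro j hj
    obtain ⟨d, rfl⟩ := Nat.exists_eq_add_of_le hj
    have h1 := psum_bounds a (fun k => x (N + k)) hz j d
    have h2 := psum_bounds a (fun k => x (N + k)) hz 0 j
    simp only [zero_add, Finset.range_zero, Finset.sum_empty] at h1 h2
    constructor <;> linarith [h1.1, h2.1]
  · right
    apply key
    intro j hj
    obtain ⟨d, rfl⟩ := Nat.exists_eq_add_of_le hj
    have h1 := psum_bounds a (fun k => x (N + k)) hz j d
    have h2 := psum_bounds a (fun k => x (N + k)) hz 0 j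
    simp only [zero_add, Finset.range_zero, Finset.sum_empty] at h1 h2
    push_cast at hL
    constructor <;> linarith [h1.2, h2.2]

lemma covering_aux (α β l L : ℕ) (hl : l * α ≤ β) (hL : L * α ≤ β + 1)
    (s0 : ℤ) (hs0 : 0 ≤ s0 ∧ s0 ≤ (β : ℤ)) (m : ℕ) :
    ∃ V : Finset (ℕ → ℤ), V.card ≤ 2 ^ m ∧ (∀ v ∈ V, ∀ k, 0 ≤ v k ∧ v k ≤ (α : ℤ)) ∧
      ∀ x : ℕ → ℤ, (∀ k, 0 ≤ x k ∧ x k ≤ (α : ℤ)) → ∃ v ∈ V, feasible β (l + m * L) s0 x v := by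
  classical
  induction m with
  | zero =>
    refine ⟨{fun k => max s0 (((k + 1 : ℕ) : ℤ) * α) - max s0 ((k : ℤ) * α)}, by simp, ?_, ?_⟩
    · intro v hv k
      rw [Finset.mem_singleton] at hv
      subst hv
      have : ((k + 1 : ℕ) : ℤ) * α = (k : ℤ) * α + α := by push_cast; ring
      simp only [this]
      omega
    · intro x hx
      refine ⟨_, Finset.mem_singleton_self _, ?_⟩
      intro i hi
      unfold battState
      rw [Finset.sum_range_sub (fun k : ℕ => max s0 ((k : ℤ) * α))]
      have h2 := psum_bounds α x hx 0 i
      simp only [zero_add, Finset.range_zero, Finset.sum_empty] at h2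
      have h3 : (i : ℤ) * α ≤ β := by
        have : i * α ≤ l * α := Nat.mul_le_mul_right _ (by omega)
        exact_mod_cast this.trans hl
      have h4 : max s0 (((0 : ℕ) : ℤ) * α) = s0 := by simp [hs0.1]
      rw [h4]
      omega
  | succ m ih =>
    obtain ⟨V, hc, hr, hcov⟩ := ih
    refine ⟨V.image (extReq (l + m * L) 0) ∪ V.image (extReq (l + m * L) α), ?_, ?_, ?_⟩
    · have h1 := Finset.card_union_le (V.image (extReq (l + m * L) 0))
        (V.image (extReq (l + m * L) α))
      have h2 := Finset.card_image_le (s := V) (f := extReq (l + m * L) 0)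
      have h3 := Finset.card_image_le (s := V) (f := extReq (l + m * L) α)
      rw [pow_succ]
      omega
    · intro v hv k
      simp only [Finset.mem_union, Finset.mem_image] at hv
      rcases hv with ⟨w, hw, rfl⟩ | ⟨w, hw, rfl⟩
      all_goals
        have := hr w hw k
        unfold extReq
        split_ifs <;> omega
    · intro x hx
      obtain ⟨v, hv, hf⟩ := hcov x hx
      have e : l + (m + 1) * L = l + m * L + L := by ring
      rw [e]
      rcases block_step α β (l + m * L) L (by exact_mod_cast hL) s0 x v hx hf with h | h
      · exact ⟨_, Finset.mem_union_left _ (Finset.mem_image_of_mem _ hv), h⟩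
      · exact ⟨_, Finset.mem_union_right _ (Finset.mem_image_of_mem _ hv), h⟩

/-- Covering with a constrained request alphabet. With `lam = ⌊(β+1)/α⌋`,
`l = ⌊β/α⌋` and `n ≥ l`, there is a set `V ⊆ {0,…,α}^n` with
`|V| ≤ 2 ^ ⌈(n − ⌊β/α⌋)/lam⌉` such that every consumption sequence `x ∈ X^n` has a
feasible request in `V`. -/
theorem covering_constrained_alphabet (α β n : ℕ) (hα : 1 ≤ α) (hαβ : α ≤ β + 1)
    (hn : 1 ≤ n) (s0 : ℤ) (hs0 : 0 ≤ s0 ∧ s0 ≤ (β : ℤ)) (hnl : β / α ≤ n) :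
    let lam := (β + 1) / α
    let l := β / α
    ∃ V : Set (ℕ → ℤ), V.Finite ∧
      Nat.card V ≤ 2 ^ ((n - l + lam - 1) / lam) ∧
      (∀ v ∈ V, ∀ k < n, 0 ≤ v k ∧ v k ≤ (α : ℤ)) ∧
      ∀ x : ℕ → ℤ, inX α n x → ∃ v ∈ V, feasible β n s0 x v := by

  intro lam l
  have hlam : 1 ≤ lam := (Nat.one_le_div_iff hα).mpr hαβ
  obtain ⟨V, hc, hr, hcov⟩ := covering_aux α β l lam (Nat.div_mul_le_self _ _)
    (Nat.div_mul_le_self _ _) s0 hs0 ((n - l + lam - 1) / lam)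
  have hN : n ≤ l + (n - l + lam - 1) / lam * lam := by
    have h1 := Nat.div_add_mod (n - l + lam - 1) lam
    have h2 := Nat.mod_lt (n - l + lam - 1) hlam
    rw [mul_comm] at h1
    omega
  refine ⟨↑V, V.finite_toSet, by simpa using hc, fun v hv k _ => hr v hv k, ?_⟩
  intro x hx
  obtain ⟨v, hv, hf⟩ := hcov (fun k => if k < n then x k else 0) (by
    intro k
    by_cases h : k < n
    · simpa [h] using hx k h
    · simp [h])
  refine ⟨v, hv, fun i hi => ?_⟩
  have h := hf i (by omega)
  have e : ∑ k ∈ Finset.range i, (if k < n then x k else 0) = ∑ k ∈ Finset.range i, x k := by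
    apply Finset.sum_congr rfl
    intro k hk
    have := Finset.mem_range.mp hk
    simp [show k < n by omega]
  unfold battState at *
  rwa [e] at h
end

section
/- Packing lower bound for a full horizon: let m = ⌈(β+1)/α⌉ and fix s0 ∈ S. Then there exists a set W ⊆ X^n of consumption sequences with cardinality |W| ≥ 2^{⌊n/m⌋} such that for any two distinct w, ŵ ∈ W the feasible request sets are disjoint: Y^n(s0,w) ∩ Y^n(s0,ŵ) = ∅. -/
/-- Block-constant consumption sequence: `α` on the blocks in `T`, zero elsewhere. -/
def blockSeq (α m : ℕ) (T : Finset ℕ) (k : ℕ) : ℤ := if k / m ∈ T then (α : ℤ) else 0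

lemma blockSeq_block (α m j : ℕ) (hm : 0 < m) (T : Finset ℕ) :
    ∑ k ∈ Finset.range m, blockSeq α m T (m * j + k) =
      if j ∈ T then (m : ℤ) * α else 0 := by
  have h : ∀ k ∈ Finset.range m, blockSeq α m T (m * j + k) =
      if j ∈ T then (α : ℤ) else 0 := by
    intro k hk
    have hk' := Finset.mem_range.1 hk
    have : (m * j + k) / m = j := by
      rw [Nat.mul_add_div hm, Nat.div_eq_of_lt hk', add_zero]
    simp [blockSeq, this]
  rw [Finset.sum_congr rfl h]
  split_ifs <;> simp

lemma blockSeq_sep (α m n : ℕ) (hm : 0 < m) (T T' : Finset ℕ)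
    (hT : T ⊆ Finset.range (n / m)) (hT' : T' ⊆ Finset.range (n / m)) (hne : T ≠ T') :
    ∃ i ≤ n, |∑ k ∈ Finset.range i, blockSeq α m T k -
      ∑ k ∈ Finset.range i, blockSeq α m T' k| = (m : ℤ) * α := by
  classical
  have hex : ∃ j, ¬ (j ∈ T ↔ j ∈ T') := by
    by_contra hcon
    push Not at hcon
    exact hne (Finset.ext hcon)
  have hj := Nat.find_spec hex
  have hmin := fun k => Nat.find_min hex (m := k)
  generalize Nat.find hex = j at hj hmin
  have hjN : j < n / m := by
    by_cases h : j ∈ T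
    · exact Finset.mem_range.1 (hT h)
    · exact Finset.mem_range.1 (hT' (by tauto))
  refine ⟨m * j + m, ?_, ?_⟩
  · calc m * j + m = m * (j + 1) := by ring
      _ ≤ m * (n / m) := Nat.mul_le_mul_left _ hjN
      _ ≤ n := Nat.mul_div_le n m
  · have heq : ∑ k ∈ Finset.range (m * j), blockSeq α m T k =
        ∑ k ∈ Finset.range (m * j), blockSeq α m T' k := by
      refine Finset.sum_congr rfl fun k hk => ?_
      have hlt : k / m < j := Nat.div_lt_of_lt_mul (Finset.mem_range.1 hk)
      have := not_not.1 (hmin _ hlt)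
      simp [blockSeq, this]
    have hnn : (0 : ℤ) ≤ (m : ℤ) * α := by positivity
    rw [Finset.sum_range_add, Finset.sum_range_add, heq, blockSeq_block _ _ _ hm,
      blockSeq_block _ _ _ hm, add_sub_add_left_eq_sub]
    by_cases h : j ∈ T
    · have h' : j ∉ T' := by tauto
      simp [h, h']
    · have h' : j ∈ T' := by tauto
      simp [h, h']

/-- Packing lower bound for a full horizon. With `m = ⌈(β+1)/α⌉`, there
is a set `W` of consumption sequences (supported on the first `n` steps) with
`|W| ≥ 2 ^ ⌊n/m⌋` whose feasible request sets are pairwise disjoint. -/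
theorem packing_full_horizon (α β n : ℕ) (hα : 1 ≤ α) (hn : 1 ≤ n)
    (s0 : ℤ) (hs0 : 0 ≤ s0 ∧ s0 ≤ (β : ℤ)) :
    let m := (β + α) / α
    ∃ W : Set (ℕ → ℤ), W.Finite ∧
      (∀ w ∈ W, inX α n w ∧ ∀ k, n ≤ k → w k = 0) ∧
      2 ^ (n / m) ≤ Nat.card W ∧
      ∀ w ∈ W, ∀ w' ∈ W, w ≠ w' →
        ∀ y : ℕ → ℤ, ¬ (feasible β n s0 w y ∧ feasible β n s0 w' y) := by
  intro m
  have hm : 0 < m := Nat.div_pos (by omega) hα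
  have hmα : (β : ℤ) + 1 ≤ (m : ℤ) * α := by
    have h1 := Nat.div_add_mod (β + α) α
    have h2 := Nat.mod_lt (β + α) (show 0 < α from hα)
    have h3 : β + 1 ≤ m * α := by
      have : m * α = α * ((β + α) / α) := Nat.mul_comm _ _
      omega
    exact_mod_cast h3
  have hinj : Set.InjOn (blockSeq α m) ((Finset.range (n / m)).powerset : Set (Finset ℕ)) := by
    intro T hT T' hT' h
    by_contra hne
    obtain ⟨i, -, hi⟩ := blockSeq_sep α m n hm T T' (Finset.mem_powerset.1 (Finset.mem_coe.1 hT)) (Finset.mem_powerset.1 (Finset.mem_coe.1 hT')) hne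
    rw [h, sub_self, abs_zero] at hi
    omega
  refine ⟨blockSeq α m '' ((Finset.range (n / m)).powerset : Set (Finset ℕ)),
    (Finset.finite_toSet _).image _, ?_, ?_, ?_⟩
  · rintro _ ⟨T, hT, rfl⟩
    have hT : T ⊆ Finset.range (n / m) := Finset.mem_powerset.1 (Finset.mem_coe.1 hT)
    refine ⟨fun k _ => ?_, fun k hk => ?_⟩
    · unfold blockSeq
      split_ifs <;> simp
    · have : k / m ∉ T := fun h => by
        have h1 := Finset.mem_range.1 (hT h)
        have h2 : n / m ≤ k / m := Nat.div_le_div_right hk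
        omega
      simp [blockSeq, this]
  · rw [Nat.card_coe_set_eq, Set.InjOn.ncard_image hinj, Set.ncard_coe_finset,
      Finset.card_powerset, Finset.card_range]
  · rintro _ ⟨T, hT, rfl⟩ _ ⟨T', hT', rfl⟩ hne y ⟨h1, h2⟩
    obtain ⟨i, hin, hi⟩ := blockSeq_sep α m n hm T T' (Finset.mem_powerset.1 (Finset.mem_coe.1 hT)) (Finset.mem_powerset.1 (Finset.mem_coe.1 hT'))
      (fun h => hne (by rw [h]))
    have a := h1 i hin
    have b := h2 i hin
    unfold battState at a b
    have : |∑ k ∈ Finset.range i, blockSeq α m T k -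
      ∑ k ∈ Finset.range i, blockSeq α m T' k| ≤ β := by
      rw [abs_le]
      constructor <;> linarith [a.1, a.2, b.1, b.2]
    omega
end
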